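/- arXiv:2006.07562 — 5 statements merged into one kernel-verified Lean document; each statement's English description precedes it below -/
import Mathlib

section
/- Let V be a symmetric positive definite d×d real matrix and C > 0 a constant with λ_min(V) ≥ C. Let y ∈ ℝ^d with y ≠ 0, and let ε, D, r > 0. Suppose that every λ ∈ ℝ^d with ‖λ‖₂ ≤ D and λᵀy ≥ ε satisfies λᵀVλ > r². Then yᵀV⁻¹y ≤ ε²·max(1/r², 1/(C·D²)). -/
open Matrix Finset

theorem stmt1 (d : ℕ) (V : Matrix (Fin d) (Fin d) ℝ) (hV : V.PosDef)
    (C : ℝ) (hC : 0 < C)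
    (hmin : ∀ v : Fin d → ℝ, C * (∑ i, v i ^ 2) ≤ v ⬝ᵥ V.mulVec v)
    (y : Fin d → ℝ) (hy : y ≠ 0)
    (ε D r : ℝ) (hε : 0 < ε) (hD : 0 < D) (hr : 0 < r)
    (h : ∀ l : Fin d → ℝ, Real.sqrt (∑ i, l i ^ 2) ≤ D → ε ≤ l ⬝ᵥ y →
      r ^ 2 < l ⬝ᵥ V.mulVec l) :
    y ⬝ᵥ V⁻¹.mulVec y ≤ ε ^ 2 * max (1 / r ^ 2) (1 / (C * D ^ 2)) := by
  set z := V⁻¹.mulVec y with hz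
  have hVz : V.mulVec z = y := by
    rw [hz, mulVec_mulVec, mul_nonsing_inv V ((isUnit_iff_isUnit_det V).mp hV.isUnit), one_mulVec]
  have hzpos : 0 < ∑ i, z i ^ 2 := by
    have hz0 : z ≠ 0 := fun h0 => hy (by rw [← hVz, h0, mulVec_zero])
    obtain ⟨i, hi⟩ := Function.ne_iff.mp hz0
    exact sum_pos' (fun j _ => sq_nonneg (z j)) ⟨i, mem_univ i, sq_pos_of_ne_zero hi⟩
  set q := y ⬝ᵥ z with hq
  have hzy : z ⬝ᵥ y = q := dotProduct_comm z y
  have hqpos : 0 < q := by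
    have hqz := hmin z
    rw [hVz, hzy] at hqz
    exact (mul_pos hC hzpos).trans_le hqz
  have hly : ((ε / q) • z) ⬝ᵥ y = ε := by
    rw [smul_dotProduct, hzy, smul_eq_mul, div_mul_cancel₀ _ hqpos.ne']
  have hlV : ((ε / q) • z) ⬝ᵥ V.mulVec ((ε / q) • z) = ε ^ 2 / q := by
    rw [mulVec_smul, hVz, dotProduct_smul, hly, smul_eq_mul]
    ring
  rw [mul_max_of_nonneg _ _ (sq_nonneg ε), mul_one_div, mul_one_div, le_max_iff]
  by_cases hl : Real.sqrt (∑ i, ((ε / q) • z) i ^ 2) ≤ D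
  · left
    have hr' := h _ hl hly.ge
    rw [hlV, lt_div_iff₀ hqpos] at hr'
    rw [le_div_iff₀ (by positivity)]
    linarith
  · right
    have hD' := (Real.lt_sqrt hD.le).mp (not_le.mp hl)
    have hC' := (mul_lt_mul_of_pos_left hD' hC).trans_le (hmin _)
    rw [hlV, lt_div_iff₀ hqpos] at hC'
    rw [le_div_iff₀ (by positivity)]
    linarith
end

section
/- Let V be a symmetric positive definite d×d real matrix and C > 0 with λ_min(V) ≥ C. Let y ∈ ℝ^d with y ≠ 0, let ε, r > 0, and let D > 0 satisfy D²·C ≥ r². If every λ ∈ ℝ^d with ‖λ‖₂ ≤ D and λᵀy ≥ ε satisfies λᵀVλ > r², then yᵀV⁻¹y < ε²/r². (Case 1 of the Key Lemma: when the ellipsoid {λ : λᵀVλ ≤ r²} is contained in the ball of radius D, the ball constraint is inactive.) -/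
open Matrix Finset

/-- Case 1 of the Key Lemma: when the ellipsoid `{λ : λᵀVλ ≤ r²}` is contained in
the ball of radius `D`, the ball constraint is inactive. -/
theorem stmt2 (d : ℕ) (V : Matrix (Fin d) (Fin d) ℝ) (hV : V.PosDef)
    (C : ℝ) (hC : 0 < C)
    (hmin : ∀ v : Fin d → ℝ, C * (∑ i, v i ^ 2) ≤ v ⬝ᵥ V.mulVec v)
    (y : Fin d → ℝ) (hy : y ≠ 0)
    (ε r D : ℝ) (hε : 0 < ε) (hr : 0 < r) (hD : 0 < D)
    (hDC : r ^ 2 ≤ D ^ 2 * C)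
    (h : ∀ l : Fin d → ℝ, Real.sqrt (∑ i, l i ^ 2) ≤ D → ε ≤ l ⬝ᵥ y →
      r ^ 2 < l ⬝ᵥ V.mulVec l) :
    y ⬝ᵥ V⁻¹.mulVec y < ε ^ 2 / r ^ 2 := by
  by_contra! hle
  set w := V⁻¹ *ᵥ y with hw
  set q := y ⬝ᵥ w
  have hVw : V *ᵥ w = y := by
    rw [hw, mulVec_mulVec, mul_nonsing_inv V ((isUnit_iff_isUnit_det V).1 hV.isUnit),
      one_mulVec]
  have hq_pos : 0 < q := lt_of_lt_of_le (by positivity) hle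
  have hwy : w ⬝ᵥ y = q := dotProduct_comm w y
  have hquad : ((ε / q) • w) ⬝ᵥ V *ᵥ ((ε / q) • w) = ε ^ 2 / q := by
    rw [mulVec_smul, hVw, smul_dotProduct, dotProduct_smul, hwy]
    simp only [smul_eq_mul]
    field_simp
  have hquad_le : ε ^ 2 / q ≤ r ^ 2 := by
    rw [div_le_iff₀ (by positivity)] at hle ⊢
    linarith
  have hnorm : Real.sqrt (∑ i, ((ε / q) • w) i ^ 2) ≤ D := by
    refine Real.sqrt_le_iff.2 ⟨hD.le, le_of_mul_le_mul_left ?_ hC⟩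
    have := hmin ((ε / q) • w)
    linarith
  have hdot : ε ≤ ((ε / q) • w) ⬝ᵥ y := by
    rw [smul_dotProduct, hwy, smul_eq_mul, div_mul_cancel₀ _ hq_pos.ne']
  have := h _ hnorm hdot
  linarith
end

section
/- Fix K ≥ 1. Let (w_t)_{t≥1} be a sequence of probability vectors on {1,…,K} (so w_t^k ≥ 0 and Σ_{k=1}^K w_t^k = 1 for every t), and suppose Σ_{s=1}^K w_s^k = 1 for every k ∈ {1,…,K}. Define counts n_t ∈ ℕ^K for t ≥ K recursively by: n_K^k = 1 for all k; and for each t > K, choose k_t ∈ argmin_{k∈{1,…,K}} n_{t−1}^k / (Σ_{s=1}^t w_s^k), set n_t^{k_t} := n_{t−1}^{k_t} + 1 and n_t^j := n_{t−1}^j for j ≠ k_t. Then for every t ≥ K and every k ∈ {1,…,K}: Σ_{s=1}^t w_s^k − (K−1) ≤ n_t^k ≤ Σ_{s=1}^t w_s^k + 1. (Tracking lemma: the pull counts track the cumulative sampling weights.) -/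
open Finset

/-- Tracking lemma: the pull counts track the cumulative sampling weights. -/
theorem stmt8 (K : ℕ) (hK : 1 ≤ K)
    (w : ℕ → Fin K → ℝ)
    (hw : ∀ t, 1 ≤ t → (∀ k, 0 ≤ w t k) ∧ ∑ k, w t k = 1)
    (hwK : ∀ k, ∑ s ∈ Finset.Icc 1 K, w s k = 1)
    (n : ℕ → Fin K → ℕ)
    (hnK : ∀ k, n K k = 1)
    (hstep : ∀ t, K < t → ∃ kt : Fin K,
      (∀ j : Fin K, (n (t - 1) kt : ℝ) / (∑ s ∈ Finset.Icc 1 t, w s kt) ≤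
            (n (t - 1) j : ℝ) / (∑ s ∈ Finset.Icc 1 t, w s j)) ∧
      n t kt = n (t - 1) kt + 1 ∧ ∀ j : Fin K, j ≠ kt → n t j = n (t - 1) j) :
    ∀ t, K ≤ t → ∀ k : Fin K,
      (∑ s ∈ Finset.Icc 1 t, w s k) - ((K : ℝ) - 1) ≤ (n t k : ℝ) ∧
      (n t k : ℝ) ≤ (∑ s ∈ Finset.Icc 1 t, w s k) + 1 := by
  obtain ⟨W, hW⟩ : ∃ W : ℕ → Fin K → ℝ, W = fun t k => ∑ s ∈ Finset.Icc 1 t, w s k := ⟨_, rfl⟩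
  have hWa : ∀ t k, ∑ s ∈ Finset.Icc 1 t, w s k = W t k := fun t k => by rw [hW]
  have hsucc : ∀ t k, W (t + 1) k = W t k + w (t + 1) k := fun t k => by
    rw [← hWa, ← hWa, Finset.sum_Icc_succ_top (by omega)]
  have hsum : ∀ t, ∑ k, W t k = (t : ℝ) := fun t => by
    induction t with
    | zero => simp [hW]
    | succ t ih =>
      simp_rw [hsucc]
      rw [Finset.sum_add_distrib, ih, (hw (t + 1) (by omega)).2]
      push_cast
      rfl
  simp_rw [hWa] at hwK hstep ⊢
  have hmono : ∀ t k, W t k ≤ W (t + 1) k := fun t k => by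
    rw [hsucc]
    linarith [(hw (t + 1) (by omega)).1 k]
  have hone : ∀ t, K ≤ t → ∀ k, 1 ≤ W t k := fun t ht k => by
    rw [← hwK k]
    exact monotone_nat_of_le_succ (fun t => hmono t k) ht
  have upper : ∀ t, K ≤ t →
      ∑ k, (n t k : ℝ) = t ∧ ∀ k, (n t k : ℝ) ≤ W t k + 1 := fun t ht => by
    induction t, ht using Nat.le_induction with
    | base => simp [hnK, hwK]
    | succ t ht ih =>
      obtain ⟨ihs, ihu⟩ := ih
      obtain ⟨i, hmin, hi, hne⟩ := hstep (t + 1) (by omega)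
      simp only [Nat.add_sub_cancel] at hmin hi hne
      have hpos : ∀ k, 0 < W (t + 1) k := fun k =>
        one_pos.trans_le (hone (t + 1) (by omega) k)
      refine ⟨?_, fun k => ?_⟩
      · have : ∀ k, (n (t + 1) k : ℝ) = n t k + if k = i then 1 else 0 := fun k => by
          by_cases h : k = i
          · subst h
            simp [hi]
          · simp [h, hne k h]
        simp_rw [this]
        rw [Finset.sum_add_distrib, ihs]
        simp
      · by_cases h : k = i
        · subst h
          have hle : (n t k : ℝ) ≤ W (t + 1) k := by
            by_contra! hlt
            have hlt' : ∀ j, W (t + 1) j < n t j := fun j =>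
              (one_lt_div (hpos j)).1 (((one_lt_div (hpos k)).2 hlt).trans_le (hmin j))
            have := Finset.sum_le_sum fun j (_ : j ∈ Finset.univ) => (hlt' j).le
            rw [hsum, ihs] at this
            push_cast at this
            linarith
          rw [hi]
          push_cast
          linarith
        · rw [hne k h]
          linarith [ihu k, hmono t k]
  intro t ht k
  obtain ⟨hs, hu⟩ := upper t ht
  refine ⟨?_, hu k⟩
  have hothers : ∑ j ∈ Finset.univ.erase k, (n t j : ℝ) ≤
      ∑ j ∈ Finset.univ.erase k, (W t j + 1) := Finset.sum_le_sum fun j _ => hu j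
  rw [Finset.sum_add_distrib, Finset.sum_const, Finset.card_erase_of_mem (Finset.mem_univ k),
    Finset.card_univ, Fintype.card_fin, nsmul_eq_mul, mul_one, Nat.cast_sub hK,
    Nat.cast_one] at hothers
  have hn := Finset.add_sum_erase Finset.univ (fun j => (n t j : ℝ)) (Finset.mem_univ k)
  have hWk := Finset.add_sum_erase Finset.univ (W t) (Finset.mem_univ k)
  rw [hs] at hn
  rw [hsum] at hWk
  linarith
end

section
/- Fix K ≥ 2 and M > 0, and let (ℓ_t)_{t≥1} be any sequence of loss vectors with ℓ_t ∈ [0, M]^K. Consider the doubling-trick exponentially weighted average forecaster: for each epoch j = 0, 1, 2, …, during rounds t ∈ {2^j, …, 2^{j+1}−1} it uses learning rate η_j := (1/M)·√(8·ln K / 2^j) and plays the probability vector w_t with coordinates w_t^k := exp(−η_j·Σ_{s=2^j}^{t−1} ℓ_s^k) / Σ_{i=1}^K exp(−η_j·Σ_{s=2^j}^{t−1} ℓ_s^i) (where the empty sum is 0). Then for every horizon T ≥ 1, its regret satisfies Σ_{t=1}^T Σ_{k=1}^K w_t^k ℓ_t^k − min_{k∈{1,…,K}} Σ_{t=1}^T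 ℓ_t^k ≤ M·√(T·ln K)/(√2 − 1). -/
open Finset

/-- **Hoeffding's lemma** for a finitely supported probability distribution. -/
theorem hoeffding_finite {ι : Type*} [Fintype ι] {p x : ι → ℝ} {M : ℝ} (hp : ∀ i, 0 ≤ p i)
    (hsum : ∑ i, p i = 1) (hx : ∀ i, x i ∈ Set.Icc 0 M) (η : ℝ) :
    ∑ i, p i * Real.exp (-η * x i) ≤
      Real.exp (-η * ∑ i, p i * x i + η ^ 2 * M ^ 2 / 8) := by
  classical
  let : MeasurableSpace ι := ⊤
  let μ : MeasureTheory.Measure ι := ∑ i, ENNReal.ofReal (p i) • MeasureTheory.Measure.dirac i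
  have integral_eq (f : ι → ℝ) : ∫ i, f i ∂μ = ∑ i, p i * f i := by
    have hint (i : ι) : MeasureTheory.Integrable f
        (ENNReal.ofReal (p i) • MeasureTheory.Measure.dirac i) :=
      MeasureTheory.Integrable.smul_measure .of_finite ENNReal.ofReal_ne_top
    rw [MeasureTheory.integral_finsetSum_measure fun i _ => hint i]
    simp [MeasureTheory.integral_smul_measure, ENNReal.toReal_ofReal (hp _)]
  have : MeasureTheory.IsProbabilityMeasure μ := ⟨by
    simp [μ, ← ENNReal.ofReal_sum_of_nonneg fun i _ => hp i, hsum]⟩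
  have h := (ProbabilityTheory.hasSubgaussianMGF_of_mem_Icc (μ := μ) (X := x)
    (measurable_of_finite x).aemeasurable (.of_forall hx)).mgf_le (-η)
  simp only [ProbabilityTheory.mgf, integral_eq] at h
  have hfac (i : ι) : p i * Real.exp (-η * (x i - ∑ j, p j * x j)) =
      p i * Real.exp (-η * x i) * Real.exp (η * ∑ j, p j * x j) := by
    rw [mul_assoc, ← Real.exp_add]; ring_nf
  simp only [hfac, ← Finset.sum_mul] at h
  rw [← le_div_iff₀ (Real.exp_pos _), ← Real.exp_sub] at h
  refine h.trans_eq (congrArg Real.exp ?_)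
  simp [div_pow]
  ring

/-- Potential bound for exponential weights started at round `a`. -/
theorem sum_exp_neg_cumulative_loss_le {K : ℕ} (hK : 0 < K) {M : ℝ} {a : ℕ} {ℓ w : ℕ → Fin K → ℝ}
    {η : ℝ} (n : ℕ) (hℓ : ∀ t, a ≤ t → ∀ k, ℓ t k ∈ Set.Icc (0 : ℝ) M)
    (hw : ∀ t ∈ Ico a (a + n), ∀ k, w t k =
      Real.exp (-η * ∑ s ∈ Ico a t, ℓ s k) / ∑ i, Real.exp (-η * ∑ s ∈ Ico a t, ℓ s i)) :
    ∑ k, Real.exp (-η * ∑ s ∈ Ico a (a + n), ℓ s k) ≤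
      K * Real.exp (-η * (∑ t ∈ Ico a (a + n), ∑ k, w t k * ℓ t k) +
        n * (η ^ 2 * M ^ 2 / 8)) := by
  induction n with
  | zero => simp
  | succ n ih =>
    have : Nonempty (Fin K) := ⟨⟨0, hK⟩⟩
    have ih := ih fun t ht => hw t (by simp at ht ⊢; omega)
    have hwn := hw (a + n) (by simp)
    rw [← add_assoc]
    simp only [sum_Ico_succ_top (Nat.le_add_right a n), mul_add, Real.exp_add]
    set W := ∑ k, Real.exp (-η * ∑ s ∈ Ico a (a + n), ℓ s k)
    have hW : 0 < W := sum_pos (fun _ _ => Real.exp_pos _) univ_nonempty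
    have hstep := hoeffding_finite (p := w (a + n)) (x := ℓ (a + n)) (M := M)
      (fun k => by rw [hwn]; positivity)
      (by simp only [hwn, ← Finset.sum_div]; exact div_self hW.ne')
      (hℓ _ (by omega)) η
    have hmul (k : Fin K) : Real.exp (-η * ∑ s ∈ Ico a (a + n), ℓ s k) *
        Real.exp (-η * ℓ (a + n) k) = W * (w (a + n) k * Real.exp (-η * ℓ (a + n) k)) := by
      rw [hwn]; field_simp
    simp only [hmul, ← Finset.mul_sum]
    refine (mul_le_mul ih hstep (sum_nonneg fun k _ => by rw [hwn]; positivity) (by positivity)).trans_eq ?_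
    rw [mul_assoc, ← Real.exp_add, ← Real.exp_add, ← Real.exp_add]
    push_cast
    ring_nf

/-- Regret of exponential weights against a fixed expert, for an arbitrary learning rate. -/
theorem exp_weights_regret_le {K : ℕ} {M : ℝ} {a : ℕ} {ℓ w : ℕ → Fin K → ℝ}
    {η : ℝ} (hη : 0 < η) (n : ℕ) (hℓ : ∀ t, a ≤ t → ∀ k, ℓ t k ∈ Set.Icc (0 : ℝ) M)
    (hw : ∀ t ∈ Ico a (a + n), ∀ k, w t k =
      Real.exp (-η * ∑ s ∈ Ico a t, ℓ s k) / ∑ i, Real.exp (-η * ∑ s ∈ Ico a t, ℓ s i))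
    (k : Fin K) :
    ∑ t ∈ Ico a (a + n), (∑ i, w t i * ℓ t i - ℓ t k) ≤
      Real.log K / η + n * (η * M ^ 2 / 8) := by
  have hK : 0 < K := k.pos
  have h := (single_le_sum (f := fun k => Real.exp (-η * ∑ s ∈ Ico a (a + n), ℓ s k))
    (fun _ _ => (Real.exp_pos _).le) (mem_univ k)).trans
    (sum_exp_neg_cumulative_loss_le hK n hℓ hw)
  have hK' : (0 : ℝ) < K := by exact_mod_cast hK
  have h := Real.log_le_log (Real.exp_pos _) h
  rw [Real.log_mul hK'.ne' (Real.exp_pos _).ne', Real.log_exp, Real.log_exp] at h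
  rw [sum_sub_distrib, ← mul_le_mul_iff_right₀ hη]
  have : η * (Real.log K / η + n * (η * M ^ 2 / 8)) =
      Real.log K + n * (η ^ 2 * M ^ 2 / 8) := by field_simp
  rw [this]
  linarith

/-- Regret within a (possibly partial) epoch of length at most `N`, with the rate tuned to `N`. -/
theorem exp_weights_regret_le_sqrt {K : ℕ} (hK : 2 ≤ K) {M : ℝ} (hM : 0 < M) {a : ℕ}
    {ℓ w : ℕ → Fin K → ℝ} {η N : ℝ} (hN : 0 < N)
    (hη : η = (1 / M) * Real.sqrt (8 * Real.log K / N)) {n : ℕ} (hn : n ≤ N)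
    (hℓ : ∀ t, a ≤ t → ∀ k, ℓ t k ∈ Set.Icc (0 : ℝ) M)
    (hw : ∀ t ∈ Ico a (a + n), ∀ k, w t k =
      Real.exp (-η * ∑ s ∈ Ico a t, ℓ s k) / ∑ i, Real.exp (-η * ∑ s ∈ Ico a t, ℓ s i))
    (k : Fin K) :
    ∑ t ∈ Ico a (a + n), (∑ i, w t i * ℓ t i - ℓ t k) ≤
      M * Real.sqrt (Real.log K / 2) * Real.sqrt N := by
  have hlog : 0 < Real.log K := Real.log_pos (by exact_mod_cast hK)
  have hη_pos : 0 < η := by rw [hη]; positivity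
  refine (exp_weights_regret_le hη_pos n hℓ hw k).trans ?_
  have hη' : η = 4 * Real.sqrt (Real.log K / 2) / (M * Real.sqrt N) := by
    rw [hη, show 8 * Real.log K / N = 4 ^ 2 * (Real.log K / 2) / N by ring,
      Real.sqrt_div (by positivity), Real.sqrt_mul (by positivity),
      Real.sqrt_sq (by norm_num)]
    field_simp
  have hr : 0 < Real.sqrt (Real.log K / 2) := Real.sqrt_pos.2 (by positivity)
  have hr2 : Real.log K = 2 * Real.sqrt (Real.log K / 2) ^ 2 := by
    rw [Real.sq_sqrt (by positivity)]; ring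
  have hq : 0 < Real.sqrt N := Real.sqrt_pos.2 hN
  have hq2 : N = Real.sqrt N ^ 2 := (Real.sq_sqrt hN.le).symm
  calc Real.log K / η + n * (η * M ^ 2 / 8)
      ≤ Real.log K / η + N * (η * M ^ 2 / 8) := by gcongr
    _ = M * Real.sqrt (Real.log K / 2) * Real.sqrt N := by
      rw [hη']
      generalize Real.sqrt (Real.log K / 2) = r at *
      generalize Real.sqrt N = q at *
      rw [hr2, hq2]
      field_simp
      ring

/-- Regret bound for the doubling-trick exponentially weighted average forecaster. -/
theorem stmt9 (K : ℕ) (hK : 2 ≤ K) (M : ℝ) (hM : 0 < M)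
    (ℓ : ℕ → Fin K → ℝ)
    (hℓ : ∀ t, 1 ≤ t → ∀ k, ℓ t k ∈ Set.Icc (0 : ℝ) M)
    (η : ℕ → ℝ)
    (hη : ∀ j, η j = (1 / M) * Real.sqrt (8 * Real.log K / 2 ^ j))
    (w : ℕ → Fin K → ℝ)
    (hw : ∀ t, 1 ≤ t → ∀ k : Fin K,
      w t k = Real.exp (-(η (Nat.log 2 t)) *
            ∑ s ∈ Finset.Ico (2 ^ Nat.log 2 t) t, ℓ s k) /
          ∑ i : Fin K, Real.exp (-(η (Nat.log 2 t)) *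
            ∑ s ∈ Finset.Ico (2 ^ Nat.log 2 t) t, ℓ s i)) :
    ∀ T, 1 ≤ T →
      (∑ t ∈ Finset.Icc 1 T, ∑ k, w t k * ℓ t k) -
          Finset.univ.inf' ⟨⟨0, by omega⟩, Finset.mem_univ _⟩
            (fun k : Fin K => ∑ t ∈ Finset.Icc 1 T, ℓ t k) ≤
        M * Real.sqrt (T * Real.log K) / (Real.sqrt 2 - 1) := by
  intro T hT
  obtain ⟨k, -, hk⟩ := Finset.exists_mem_eq_inf' ⟨⟨0, by omega⟩, Finset.mem_univ _⟩
    (fun k : Fin K => ∑ t ∈ Finset.Icc 1 T, ℓ t k)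
  rw [hk, ← sum_sub_distrib]
  have epoch (j n : ℕ) (hn : n ≤ 2 ^ j) :
      ∑ t ∈ Ico (2 ^ j) (2 ^ j + n), (∑ i, w t i * ℓ t i - ℓ t k) ≤
        M * Real.sqrt (Real.log K / 2) * Real.sqrt 2 ^ j := by
    have h2j : 1 ≤ 2 ^ j := Nat.one_le_two_pow
    rw [show Real.sqrt 2 ^ j = Real.sqrt (2 ^ j) by
      rw [eq_comm, Real.sqrt_eq_iff_mul_self_eq (by positivity) (by positivity), ← mul_pow,
        Real.mul_self_sqrt (by norm_num)]]
    refine exp_weights_regret_le_sqrt hK hM (by positivity) (hη j) (by exact_mod_cast hn)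
      (fun t ht => hℓ t (h2j.trans ht)) (fun t ht i => ?_) k
    rw [mem_Ico] at ht
    have hlog : Nat.log 2 t = j :=
      Nat.log_eq_of_pow_le_of_lt_pow ht.1 (by rw [pow_succ]; omega)
    rw [hw t (h2j.trans ht.1), hlog]
  have hs : 1 < Real.sqrt 2 := by rw [Real.lt_sqrt] <;> norm_num
  have epochs (J : ℕ) : ∑ t ∈ Ico 1 (2 ^ J), (∑ i, w t i * ℓ t i - ℓ t k) ≤
      M * Real.sqrt (Real.log K / 2) * ∑ j ∈ range J, Real.sqrt 2 ^ j := by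
    induction J with
    | zero => simp
    | succ J ih =>
      rw [← sum_Ico_consecutive _ (Nat.one_le_two_pow (n := J))
        (Nat.pow_le_pow_right two_pos J.le_succ), sum_range_succ, mul_add]
      have := epoch J (2 ^ J) le_rfl
      rw [← mul_two, ← pow_succ] at this
      exact add_le_add ih this
  set J := Nat.log 2 T
  have hJ : 2 ^ J ≤ T := Nat.pow_log_le_self 2 (by omega)
  have hJ' : T < 2 ^ J * 2 := by rw [← pow_succ]; exact Nat.lt_pow_succ_log_self one_lt_two T
  have hlast := epoch J (T + 1 - 2 ^ J) (by omega)
  rw [show 2 ^ J + (T + 1 - 2 ^ J) = T + 1 by omega] at hlast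
  have hIcc : Icc 1 T = Ico 1 (T + 1) := by ext; simp
  rw [hIcc, ← sum_Ico_consecutive _ (Nat.one_le_two_pow (n := J)) (by omega : 2 ^ J ≤ T + 1)]
  refine (add_le_add (epochs J) hlast).trans ?_
  rw [← mul_add, ← sum_range_succ, geom_sum_eq hs.ne', mul_div_assoc']
  have hpow : Real.sqrt 2 ^ (J + 1) ≤ Real.sqrt 2 * Real.sqrt T := by
    rw [pow_succ']
    gcongr
    apply Real.le_sqrt_of_sq_le
    rw [← pow_mul, mul_comm, pow_mul, Real.sq_sqrt (by norm_num)]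
    exact_mod_cast hJ
  have hlogK : 0 ≤ Real.log K := Real.log_natCast_nonneg K
  have hfinal : Real.sqrt (T * Real.log K) =
      Real.sqrt (Real.log K / 2) * (Real.sqrt 2 * Real.sqrt T) := by
    rw [← Real.sqrt_mul (by norm_num), ← Real.sqrt_mul (by positivity)]
    ring_nf
  rw [hfinal, ← mul_assoc]
  have : 0 < Real.sqrt 2 - 1 := by linarith
  gcongr
  linarith
end

section
/- Let x_1,…,x_K ∈ ℝ^d span ℝ^d and let θ* ∈ ℝ^d be such that there is a unique x* ∈ X := {x_1,…,x_K} maximizing x ↦ θ*ᵀx over X. For w a probability vector on {1,…,K} let W(w) := Σ_{k=1}^K w^k x_k x_kᵀ, and define D_{θ*} := sup over probability vectors w with W(w) positive definite of min_{x∈X, x≠x*} (θ*ᵀ(x*−x))² / ((x*−x)ᵀW(w)⁻¹(x*−x)). For m ≥ 1 let S_m := {x ∈ X : θ*ᵀ(x*−x) < 2^{−m}} and B_m* := inf over probability vectors w with W(w) positive definite of max_{x,x'∈S_m, x≠x'} (x−x')ᵀW(w)⁻¹(x−x') (with the maximum over an empty set of pairs taken to be 0). Then 4^m·B_m* ≤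 4/D_{θ*} for every m ≥ 1, and consequently Σ_{m=1}^M 4^m·B_m* ≤ 4M/D_{θ*} for every positive integer M. -/
open Matrix Finset

/-- A positive semidefinite quadratic form satisfies `Q (u - v) ≤ 2 Q u + 2 Q v`. -/
theorem Matrix.PosSemidef.dotProduct_mulVec_sub_le {n : Type*} [Fintype n]
    {A : Matrix n n ℝ} (hA : A.PosSemidef) (u v : n → ℝ) :
    (u - v) ⬝ᵥ A *ᵥ (u - v) ≤ 2 * (u ⬝ᵥ A *ᵥ u) + 2 * (v ⬝ᵥ A *ᵥ v) := by
  have h : 0 ≤ (u + v) ⬝ᵥ A *ᵥ (u + v) := by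
    simpa using hA.dotProduct_mulVec_nonneg (u + v)
  simp only [mulVec_add, mulVec_sub, dotProduct_add, dotProduct_sub, add_dotProduct,
    sub_dotProduct] at h ⊢
  linarith

/-- If `A` is positive definite and every `x k ≠ xstar` has positive gap, the smallest ratio of
squared gap to quadratic form is positive and bounds the quadratic form by the squared gap. -/
theorem sInf_gap_ratio_pos_and_mul_le {n ι : Type*} [Fintype n] [Finite ι]
    {A : Matrix n n ℝ} (hA : A.PosDef) (x : ι → n → ℝ) (θ xstar : n → ℝ)
    (hgap : ∀ k, x k ≠ xstar → 0 < θ ⬝ᵥ (xstar - x k)) (hsub : ∃ k, x k ≠ xstar) :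
    let t := sInf {u : ℝ | ∃ k, x k ≠ xstar ∧
      u = (θ ⬝ᵥ (xstar - x k)) ^ 2 / ((xstar - x k) ⬝ᵥ A *ᵥ (xstar - x k))}
    0 < t ∧ ∀ k, t * ((xstar - x k) ⬝ᵥ A *ᵥ (xstar - x k)) ≤ (θ ⬝ᵥ (xstar - x k)) ^ 2 := by
  intro t
  have hQ : ∀ k, x k ≠ xstar → 0 < (xstar - x k) ⬝ᵥ A *ᵥ (xstar - x k) := fun k hk => by
    simpa using hA.dotProduct_mulVec_pos (sub_ne_zero.2 hk.symm)
  have hfin : {u : ℝ | ∃ k, x k ≠ xstar ∧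
      u = (θ ⬝ᵥ (xstar - x k)) ^ 2 / ((xstar - x k) ⬝ᵥ A *ᵥ (xstar - x k))}.Finite := by
    refine (Set.finite_range fun k => (θ ⬝ᵥ (xstar - x k)) ^ 2 /
      ((xstar - x k) ⬝ᵥ A *ᵥ (xstar - x k))).subset ?_
    rintro u ⟨k, -, rfl⟩
    exact ⟨k, rfl⟩
  refine ⟨?_, fun k => ?_⟩
  · obtain ⟨k₀, hk₀⟩ := hsub
    obtain ⟨k, hk, hu⟩ := hfin.isCompact.sInf_mem ⟨_, k₀, hk₀, rfl⟩
    change 0 < sInf _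
    rw [hu]
    exact div_pos (pow_pos (hgap k hk) 2) (hQ k hk)
  · by_cases hk : x k = xstar
    · simp [hk]
    · exact (le_div_iff₀ (hQ k hk)).1 (csInf_le hfin.bddBelow ⟨k, hk, rfl⟩)

theorem stmt13 (d K : ℕ) (x : Fin K → Fin d → ℝ)
    (hspan : Submodule.span ℝ (Set.range x) = ⊤)
    (θstar xstar : Fin d → ℝ) (kstar : Fin K) (hxk : x kstar = xstar)
    (hbest : ∀ k : Fin K, x k ≠ xstar → θstar ⬝ᵥ x k < θstar ⬝ᵥ xstar)
    (hsub : ∃ k : Fin K, x k ≠ xstar)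
    (W : (Fin K → ℝ) → Matrix (Fin d) (Fin d) ℝ)
    (hWdef : ∀ w, W w = ∑ k, w k • vecMulVec (x k) (x k))
    (Dθ : ℝ)
    (hD : Dθ = sSup {t : ℝ | ∃ w : Fin K → ℝ, (∀ k, 0 ≤ w k) ∧ (∑ k, w k = 1) ∧
      (W w).PosDef ∧ t = sInf {u : ℝ | ∃ k : Fin K, x k ≠ xstar ∧
        u = (θstar ⬝ᵥ (xstar - x k)) ^ 2 /
          ((xstar - x k) ⬝ᵥ (W w)⁻¹.mulVec (xstar - x k))}})
    (B : ℕ → ℝ)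
    (hB : ∀ m : ℕ, B m = sInf {t : ℝ | ∃ w : Fin K → ℝ, (∀ k, 0 ≤ w k) ∧
      (∑ k, w k = 1) ∧ (W w).PosDef ∧
      t = sSup (insert (0 : ℝ) {u : ℝ | ∃ a b : Fin K, x a ≠ x b ∧
        θstar ⬝ᵥ (xstar - x a) < (1 / 2 : ℝ) ^ m ∧
        θstar ⬝ᵥ (xstar - x b) < (1 / 2 : ℝ) ^ m ∧
        u = (x a - x b) ⬝ᵥ (W w)⁻¹.mulVec (x a - x b)})}) :
    (∀ m : ℕ, 1 ≤ m → (4 : ℝ) ^ m * B m ≤ 4 / Dθ) ∧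
    ∀ M : ℕ, 1 ≤ M →
      ∑ m ∈ Finset.Icc 1 M, (4 : ℝ) ^ m * B m ≤ 4 * (M : ℝ) / Dθ := by
  have hgap : ∀ k, x k ≠ xstar → 0 < θstar ⬝ᵥ (xstar - x k) := fun k hk => by
    rw [dotProduct_sub]
    exact sub_pos.2 (hbest k hk)
  have hgap_nonneg : ∀ k, 0 ≤ θstar ⬝ᵥ (xstar - x k) := fun k => by
    by_cases hk : x k = xstar
    · simp [hk]
    · exact (hgap k hk).le
  have hmain : ∀ m : ℕ, (4 : ℝ) ^ m * B m ≤ 4 / Dθ := by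
    intro m
    have hfour : (4 : ℝ) ^ m * ((1 / 2 : ℝ) ^ m) ^ 2 = 1 := by
      rw [← pow_mul, mul_comm m 2, pow_mul, ← mul_pow]
      norm_num
    have hDnn : 0 ≤ Dθ := by
      rw [hD]
      refine Real.sSup_nonneg ?_
      rintro t ⟨w, -, -, hw, rfl⟩
      exact (sInf_gap_ratio_pos_and_mul_le hw.inv x θstar xstar hgap hsub).1.le
    rcases le_or_gt (B m) 0 with hB0 | hB0
    · exact (mul_nonpos_of_nonneg_of_nonpos (by positivity) hB0).trans (by positivity)
    have hpos : 0 < (4 : ℝ) ^ m * B m := by positivity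
    have hbound : ∀ t ∈ {t : ℝ | ∃ w : Fin K → ℝ, (∀ k, 0 ≤ w k) ∧ (∑ k, w k = 1) ∧
        (W w).PosDef ∧ t = sInf {u : ℝ | ∃ k : Fin K, x k ≠ xstar ∧
          u = (θstar ⬝ᵥ (xstar - x k)) ^ 2 /
            ((xstar - x k) ⬝ᵥ (W w)⁻¹.mulVec (xstar - x k))}},
        0 < t ∧ t ≤ 4 / ((4 : ℝ) ^ m * B m) := by
      rintro t ⟨w, hw0, hw1, hw, ht⟩
      obtain ⟨htpos, htle⟩ := sInf_gap_ratio_pos_and_mul_le hw.inv x θstar xstar hgap hsub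
      rw [← ht] at htpos htle
      refine ⟨htpos, ?_⟩
      have hBt : B m ≤ 4 * ((1 / 2 : ℝ) ^ m) ^ 2 / t := by
        rw [hB m]
        refine le_trans (csInf_le ⟨0, ?_⟩ ⟨w, hw0, hw1, hw, rfl⟩) ?_
        · rintro s ⟨v, -, -, hv, rfl⟩
          refine Real.sSup_nonneg ?_
          rintro u (rfl | ⟨a, b, -, -, -, rfl⟩)
          · exact le_rfl
          · simpa using hv.inv.posSemidef.dotProduct_mulVec_nonneg (x a - x b)
        · refine Real.sSup_le ?_ (by positivity)
          rintro u (rfl | ⟨a, b, -, ha, hb, rfl⟩)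
          · positivity
          · have hab := hw.inv.posSemidef.dotProduct_mulVec_sub_le (xstar - x b) (xstar - x a)
            rw [sub_sub_sub_cancel_left] at hab
            rw [le_div_iff₀ htpos]
            have ha2 := pow_le_pow_left₀ (hgap_nonneg a) ha.le 2
            have hb2 := pow_le_pow_left₀ (hgap_nonneg b) hb.le 2
            have := mul_le_mul_of_nonneg_right hab htpos.le
            linarith [htle a, htle b]
      rw [le_div_iff₀ htpos] at hBt
      rw [le_div_iff₀ hpos]
      calc t * ((4 : ℝ) ^ m * B m) = 4 ^ m * (B m * t) := by ring
        _ ≤ 4 ^ m * (4 * ((1 / 2 : ℝ) ^ m) ^ 2) := by gcongr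
        _ = 4 := by linear_combination 4 * hfour
    have hfeas : ∃ w : Fin K → ℝ, (∀ k, 0 ≤ w k) ∧ (∑ k, w k = 1) ∧ (W w).PosDef := by
      by_contra hne
      refine hB0.ne' ?_
      rw [hB m]
      convert Real.sInf_empty
      refine Set.eq_empty_of_forall_notMem ?_
      rintro t ⟨w, hw0, hw1, hw, -⟩
      exact hne ⟨w, hw0, hw1, hw⟩
    obtain ⟨w, hw0, hw1, hw⟩ := hfeas
    have hDpos : 0 < Dθ := by
      rw [hD]
      exact (hbound _ ⟨w, hw0, hw1, hw, rfl⟩).1.trans_le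
        (le_csSup ⟨_, fun t ht => (hbound t ht).2⟩ ⟨w, hw0, hw1, hw, rfl⟩)
    have hDle : Dθ ≤ 4 / ((4 : ℝ) ^ m * B m) := by
      rw [hD]
      exact csSup_le ⟨_, w, hw0, hw1, hw, rfl⟩ fun t ht => (hbound t ht).2
    rw [le_div_iff₀ hpos] at hDle
    rw [le_div_iff₀ hDpos]
    linarith
  refine ⟨fun m _ => hmain m, fun M _ => ?_⟩
  calc ∑ m ∈ Finset.Icc 1 M, (4 : ℝ) ^ m * B m ≤ ∑ _m ∈ Finset.Icc 1 M, 4 / Dθ :=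
        Finset.sum_le_sum fun m _ => hmain m
    _ = 4 * (M : ℝ) / Dθ := by
        simp only [sum_const, Nat.card_Icc, Nat.add_sub_cancel, nsmul_eq_mul]
        ring
end
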